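/- arXiv:2308.09701 — 2 statements merged into one kernel-verified Lean document; each statement's English description precedes it below -/
import Mathlib

section
/- Let V = [v₁,…,vₙ] ∈ ℝ^{d×n} be a nonzero matrix and let X be the entrywise sampler of V. Then E[XᵀX] = ‖V‖_{1,1}·diag((‖v_i‖₁)_{i∈[n]}), and consequently for every nonempty C ⊆ [n], E[‖X χ_C‖²] = (‖V‖_{1,1}/|C|²)·Σ_{i∈C} ‖v_i‖₁ ≤ ‖V‖_{1,1}²/|C|². -/
open Finset Matrix

/-- `‖V‖_{1,1} = Σ_i Σ_l |V_{li}|`. -/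
noncomputable def norm11 {d n : ℕ} (V : Matrix (Fin d) (Fin n) ℝ) : ℝ :=
  ∑ i, ∑ l, |V l i|

/-- The realization of the entrywise sampler of `V` corresponding to the pair `(i, l)`:
    the matrix whose `(l, i)` entry is `‖V‖_{1,1} · sgn(V_{li})` and whose other entries
    are zero. It occurs with probability `|V_{li}| / ‖V‖_{1,1}`. -/
noncomputable def entrySample {d n : ℕ} (V : Matrix (Fin d) (Fin n) ℝ)
    (i : Fin n) (l : Fin d) : Matrix (Fin d) (Fin n) ℝ :=
  fun l' i' => if l' = l ∧ i' = i then norm11 V * Real.sign (V l i) else 0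

/-- The scaled characteristic vector `χ_C` of a nonempty `C ⊆ [n]`. -/
noncomputable def chi {n : ℕ} (C : Finset (Fin n)) : Fin n → ℝ :=
  fun i => if i ∈ C then ((C.card : ℝ))⁻¹ else 0

theorem aux_key (v N : ℝ) : |v| / N * (N * Real.sign v) ^ 2 = N * |v| := by
  by_cases hN : N = 0
  · simp [hN]
  have h : |v| * Real.sign v ^ 2 = |v| := by
    rcases lt_trichotomy v 0 with h | h | h
    · simp [Real.sign_of_neg h]
    · simp [h]
    · simp [Real.sign_of_pos h]
  calc |v| / N * (N * Real.sign v) ^ 2 = N * (|v| * Real.sign v ^ 2) := by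
        field_simp
    _ = N * |v| := by rw [h]

theorem aux_gram {d n : ℕ} (V : Matrix (Fin d) (Fin n) ℝ) (i : Fin n) (l : Fin d) :
    (|V l i| / norm11 V) • ((entrySample V i l)ᵀ * entrySample V i l)
      = Matrix.diagonal (fun j => if j = i then norm11 V * |V l i| else 0) := by
  ext a b
  rw [← aux_key]
  simp only [Matrix.smul_apply, Matrix.mul_apply, Matrix.transpose_apply, entrySample,
    Matrix.diagonal_apply, smul_eq_mul]
  rw [Finset.sum_eq_single l]
  · by_cases ha : a = i <;> by_cases hb : b = i
    · subst ha; subst hb; simp [sq]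
    · subst ha; simp [hb, Ne.symm hb]
    · simp [ha]
    · simp [ha]
  · intro x _ hx
    simp [hx]
  · simp

theorem aux_vec {d n : ℕ} (V : Matrix (Fin d) (Fin n) ℝ) (C : Finset (Fin n))
    (i : Fin n) (l : Fin d) :
    (|V l i| / norm11 V) * (∑ l', ((entrySample V i l).mulVec (chi C)) l' ^ 2)
      = norm11 V / (C.card : ℝ) ^ 2 * (if i ∈ C then |V l i| else 0) := by
  have h : ∀ l', ((entrySample V i l).mulVec (chi C)) l'
      = if l' = l then norm11 V * Real.sign (V l i) * chi C i else 0 := by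
    intro l'
    simp only [Matrix.mulVec, dotProduct, entrySample]
    by_cases hl : l' = l <;> simp [hl]
  simp only [h, ite_pow]
  rw [Finset.sum_eq_single l (by intro x _ hx; simp [hx]) (by simp)]
  rw [if_pos rfl, mul_pow, ← mul_assoc, aux_key]
  by_cases hi : i ∈ C
  · simp only [chi, hi, if_true]; rw [inv_pow]; ring
  · simp [chi, hi]

/-- `E[XᵀX] = ‖V‖_{1,1} · diag((‖v_i‖₁)_i)` for the entrywise sampler `X` of `V`, and
    consequently `E[‖X χ_C‖²] = (‖V‖_{1,1}/|C|²)·Σ_{i∈C}‖v_i‖₁ ≤ ‖V‖_{1,1}²/|C|²`. -/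
theorem stmt_6 (d n : ℕ) (V : Matrix (Fin d) (Fin n) ℝ) (hV : V ≠ 0) :
    (∑ i, ∑ l, (|V l i| / norm11 V) • ((entrySample V i l)ᵀ * entrySample V i l)
        = norm11 V • Matrix.diagonal (fun i => ∑ l, |V l i|)) ∧
    ∀ C : Finset (Fin n), C.Nonempty →
      (∑ i, ∑ l, (|V l i| / norm11 V)
            * (∑ l', ((entrySample V i l).mulVec (chi C)) l' ^ 2)
          = norm11 V / (C.card : ℝ) ^ 2 * ∑ i ∈ C, ∑ l, |V l i|) ∧
      ∑ i, ∑ l, (|V l i| / norm11 V)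
            * (∑ l', ((entrySample V i l).mulVec (chi C)) l' ^ 2)
          ≤ norm11 V ^ 2 / (C.card : ℝ) ^ 2 := by
  have hN : 0 ≤ norm11 V :=
    Finset.sum_nonneg fun i _ => Finset.sum_nonneg fun l _ => abs_nonneg _
  refine ⟨?_, fun C hC => ?_⟩
  · simp only [aux_gram]
    ext a b
    simp only [Matrix.sum_apply, Matrix.smul_apply, Matrix.diagonal_apply, smul_eq_mul]
    by_cases hab : a = b
    · subst hab
      simp only [if_true]
      rw [Finset.sum_eq_single a (by intro x _ hx; simp [Ne.symm hx]) (by simp)]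
      simp [Finset.mul_sum]
    · simp [hab]
  · have h : ∑ i, ∑ l, (|V l i| / norm11 V)
            * (∑ l', ((entrySample V i l).mulVec (chi C)) l' ^ 2)
          = norm11 V / (C.card : ℝ) ^ 2 * ∑ i ∈ C, ∑ l, |V l i| := by
      simp only [aux_vec, ← Finset.mul_sum]
      congr 1
      rw [← Finset.sum_filter_add_sum_filter_not Finset.univ (fun i => i ∈ C)]
      rw [Finset.sum_congr rfl (g := fun i => ∑ l, |V l i|)
        (by intro x hx; simp [(Finset.mem_filter.1 hx).2])]
      rw [Finset.sum_eq_zero (s := Finset.univ.filter (fun i => i ∉ C))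
        (by intro x hx; simp [(Finset.mem_filter.1 hx).2])]
      simp
    refine ⟨h, h.trans_le ?_⟩
    have h2 : ∑ i ∈ C, ∑ l, |V l i| ≤ norm11 V :=
      Finset.sum_le_sum_of_subset_of_nonneg (Finset.subset_univ C)
        fun i _ _ => Finset.sum_nonneg fun l _ => abs_nonneg _
    calc _ ≤ norm11 V / (C.card : ℝ) ^ 2 * norm11 V :=
          mul_le_mul_of_nonneg_left h2 (by positivity)
      _ = _ := by ring
end

section
/- Let V = [v₁,…,vₙ] ∈ ℝ^{d×n}, let C ⊆ [n] be nonempty with ‖V‖_{2,1} > 0, let ε₁ ∈ (0, |C|/(2n)] and ε₂ ≥ 0, let P ∈ ℝ satisfy |P − |C|/n| ≤ ε₁, and let Q ∈ ℝ^d satisfy ‖Q − Σ_{i∈C} v_i/‖V‖_{2,1}‖_∞ ≤ ε₂. Then P > 0 and the vector c := (‖V‖_{2,1}/(nP))·Q satisfies ‖c − |C|⁻¹ Σ_{i∈C} v_i‖ ≤ (2n‖V‖/|C|^{3/2})·ε₁ + (2√d·‖V‖_{2,1}/|C|)·ε₂. -/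
open Finset Matrix

/-- The Euclidean norm of a vector in `ℝ^d`. -/
noncomputable def euclNorm {d : ℕ} (x : Fin d → ℝ) : ℝ :=
  Real.sqrt (∑ l, x l ^ 2)

/-- The Euclidean norm of the `i`-th column of `V`. -/
noncomputable def colNorm {d n : ℕ} (V : Matrix (Fin d) (Fin n) ℝ) (i : Fin n) : ℝ :=
  Real.sqrt (∑ l, V l i ^ 2)

/-- `‖V‖_{2,1} = Σ_i ‖v_i‖`. -/
noncomputable def norm21 {d n : ℕ} (V : Matrix (Fin d) (Fin n) ℝ) : ℝ :=
  ∑ i, colNorm V i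

/-- The spectral (operator) norm of `V`. -/
noncomputable def specNorm {d n : ℕ} (V : Matrix (Fin d) (Fin n) ℝ) : ℝ :=
  ‖LinearMap.toContinuousLinearMap (Matrix.toEuclideanLin V)‖

theorem euclNorm_eq {d : ℕ} (x : Fin d → ℝ) : euclNorm x = ‖WithLp.toLp 2 x‖ := by
  simp [euclNorm, EuclideanSpace.norm_eq]

theorem euclNorm_sum_le {d n : ℕ} (V : Matrix (Fin d) (Fin n) ℝ) (C : Finset (Fin n)) :
    euclNorm (fun l => ∑ i ∈ C, V l i) ≤ specNorm V * Real.sqrt C.card := by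
  classical
  have h := (LinearMap.toContinuousLinearMap (Matrix.toEuclideanLin V)).le_opNorm
    (WithLp.toLp 2 (fun i => if i ∈ C then (1 : ℝ) else 0))
  have h1 : ‖(WithLp.toLp 2 (fun i => if i ∈ C then (1 : ℝ) else 0) : EuclideanSpace ℝ (Fin n))‖
      = Real.sqrt C.card := by
    rw [EuclideanSpace.norm_eq]
    congr 1
    simp [apply_ite, ite_pow]
  have h2 : (LinearMap.toContinuousLinearMap (Matrix.toEuclideanLin V))
    (WithLp.toLp 2 (fun i => if i ∈ C then (1 : ℝ) else 0))
      = WithLp.toLp 2 (fun l => ∑ i ∈ C, V l i) := by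
    ext l
    simp [Matrix.mulVec, dotProduct]
  rw [h1, h2, ← euclNorm_eq] at h
  exact h

theorem euclNorm_le_sqrt {d : ℕ} (x : Fin d → ℝ) (e : ℝ) (he : 0 ≤ e) (h : ∀ l, |x l| ≤ e) :
    euclNorm x ≤ Real.sqrt d * e := by
  unfold euclNorm
  apply Real.sqrt_le_iff.2 ⟨by positivity, ?_⟩
  rw [mul_pow, Real.sq_sqrt (by positivity)]
  calc ∑ l, x l ^ 2 ≤ ∑ _l : Fin d, e ^ 2 :=
        Finset.sum_le_sum fun l _ => sq_le_sq' (abs_le.1 (h l)).1 (abs_le.1 (h l)).2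
    _ = d * e ^ 2 := by simp

theorem euclNorm_comb {d : ℕ} (a b : ℝ) (x y : Fin d → ℝ) :
    euclNorm (a • x + b • y) ≤ |a| * euclNorm x + |b| * euclNorm y := by
  simp only [euclNorm_eq, WithLp.toLp_add, WithLp.toLp_smul]
  refine (norm_add_le _ _).trans ?_
  simp [norm_smul]

/-- Combining an `ε₁`-accurate estimate `P` of `|C|/n` with an entrywise `ε₂`-accurate
    estimate `Q` of `Σ_{i∈C} v_i/‖V‖_{2,1}` yields a centroid estimate
    `c = (‖V‖_{2,1}/(nP))·Q` with
    `‖c − |C|⁻¹Σ_{i∈C}v_i‖ ≤ (2n‖V‖/|C|^{3/2})ε₁ + (2√d‖V‖_{2,1}/|C|)ε₂`. -/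
theorem stmt_12 (d n : ℕ) (V : Matrix (Fin d) (Fin n) ℝ)
    (C : Finset (Fin n)) (hC : C.Nonempty) (h21 : 0 < norm21 V)
    (ε₁ ε₂ : ℝ) (hε₁ : 0 < ε₁) (hε₁' : ε₁ ≤ (C.card : ℝ) / (2 * n)) (hε₂ : 0 ≤ ε₂)
    (P : ℝ) (hP : |P - (C.card : ℝ) / n| ≤ ε₁)
    (Q : Fin d → ℝ) (hQ : ∀ l, |Q l - (∑ i ∈ C, V l i) / norm21 V| ≤ ε₂) :
    0 < P ∧
    euclNorm ((norm21 V / (n * P)) • Q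
        - ((C.card : ℝ))⁻¹ • (fun l => ∑ i ∈ C, V l i))
      ≤ 2 * n * specNorm V / ((C.card : ℝ) * Real.sqrt C.card) * ε₁
        + 2 * Real.sqrt d * norm21 V / C.card * ε₂ := by
  have hk : (0 : ℝ) < C.card := by exact_mod_cast hC.card_pos
  have hn : (0 : ℝ) < n := by
    obtain ⟨i, _⟩ := hC
    exact_mod_cast i.pos
  have hS := euclNorm_sum_le V C
  set k : ℝ := (C.card : ℝ) with hkdef
  set N := norm21 V with hN
  have hhalf : k / (2 * n) = k / n / 2 := by field_simp
  have hP2 : k / n / 2 ≤ P := by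
    have := (abs_le.1 hP).1
    linarith
  have hP0 : 0 < P := lt_of_lt_of_le (by positivity) hP2
  refine ⟨hP0, ?_⟩
  have hnP : k ≤ 2 * (n * P) := by
    rw [div_div, div_le_iff₀ (by positivity)] at hP2
    linarith
  have hnP0 : 0 < n * P := by positivity
  have hinv : 1 / (n * P) ≤ 2 / k := by
    rw [div_le_div_iff₀ hnP0 hk]; linarith
  have hdec : (N / (n * P)) • Q - k⁻¹ • (fun l => ∑ i ∈ C, V l i)
      = (1 / (n * P) - k⁻¹) • (fun l => ∑ i ∈ C, V l i)
        + (N / (n * P)) • (fun l => Q l - (∑ i ∈ C, V l i) / N) := by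
    ext l
    simp only [Pi.sub_apply, Pi.add_apply, Pi.smul_apply, smul_eq_mul]
    field_simp
    ring
  have hQ' := euclNorm_le_sqrt _ ε₂ hε₂ hQ
  rw [hdec]
  refine (euclNorm_comb _ _ _ _).trans (add_le_add ?_ ?_)
  · have hcoef : |1 / (n * P) - k⁻¹| ≤ 2 * n / k ^ 2 * ε₁ := by
      have e : 1 / (n * P) - k⁻¹ = -(P - k / n) * (1 / (n * P)) * (n / k) := by
        field_simp
        ring
      rw [e, abs_mul, abs_mul, abs_neg, abs_of_pos (by positivity : 0 < 1 / (n * P)),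
        abs_of_pos (by positivity : 0 < (n : ℝ) / k)]
      calc |P - k / n| * (1 / (n * P)) * (n / k) ≤ ε₁ * (2 / k) * (n / k) := by gcongr
        _ = _ := by field_simp
    have hs0 : 0 < Real.sqrt k := Real.sqrt_pos.2 hk
    have hsq : Real.sqrt k ^ 2 = k := Real.sq_sqrt hk.le
    calc _ ≤ 2 * n / k ^ 2 * ε₁ * (specNorm V * Real.sqrt k) :=
          mul_le_mul hcoef hS (Real.sqrt_nonneg _) (by positivity)
      _ = _ := by
        have : Real.sqrt k / k ^ 2 = 1 / (k * Real.sqrt k) := by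
          rw [div_eq_div_iff (by positivity) (by positivity)]
          linear_combination k * hsq
        calc _ = 2 * n * ε₁ * specNorm V * (Real.sqrt k / k ^ 2) := by ring
          _ = _ := by rw [this]; ring
  · rw [abs_of_pos (by positivity)]
    calc N / (n * P) * _ ≤ N * (2 / k) * (Real.sqrt d * ε₂) := by
          rw [div_eq_mul_one_div]
          exact mul_le_mul (by gcongr) hQ' (Real.sqrt_nonneg _) (by positivity)
      _ = _ := by ring
end
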